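/- Fix −1 < ρ < 1 and let δ > 0. Then there exists c > 0 such that for every z ∈ ℂ with dist(z, E_ρ) ≥ δ, the unique probability measure ν_z on ℝ whose Stieltjes transform a(η,z) := ∫_ℝ 1/(u − η) dν_z(u) satisfies 1/(a(η,z)·(η + a(η,z))) + 1 = Re(z)²/(η + (1+ρ)a(η,z))² + Im(z)²/(η + (1−ρ)a(η,z))² for all η in the upper half plane, assigns zero mass to the interval [−c, c], i.e. ν_z([−c,c]) = 0. -/

import Mathlib

open MeasureTheory

noncomputable section

/-- The ellipse `E_ρ` (for `−1 < ρ < 1`). -/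
def ellipse (ρ : ℝ) : Set ℂ :=
  if ρ = 1 then {z : ℂ | z.im = 0 ∧ |z.re| ≤ 2}
  else if ρ = -1 then {z : ℂ | z.re = 0 ∧ |z.im| ≤ 2}
  else {z : ℂ | z.re ^ 2 / (1 + ρ) ^ 2 + z.im ^ 2 / (1 - ρ) ^ 2 ≤ 1}

/-- The Stieltjes transform of a measure `ν` on `ℝ`, evaluated at `η ∈ ℂ⁺`. -/
def stieltjes (ν : Measure ℝ) (η : ℂ) : ℂ :=
  ∫ u : ℝ, ((u : ℂ) - η)⁻¹ ∂ν

/-- The self-consistent equation satisfied by the Stieltjes transform `a(·,z)` of `ν_z`. -/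
def SelfConsistent (ρ : ℝ) (z : ℂ) (ν : Measure ℝ) : Prop :=
  ∀ η : ℂ, 0 < η.im →
    1 / (stieltjes ν η * (η + stieltjes ν η)) + 1 =
      (z.re : ℂ) ^ 2 / (η + (1 + ρ) * stieltjes ν η) ^ 2 +
        (z.im : ℂ) ^ 2 / (η + (1 - ρ) * stieltjes ν η) ^ 2

set_option maxHeartbeats 1000000 in
lemma core_bound (g : ℝ) (hg : 0 < g) : ∃ r : ℝ, 0 < r ∧ r ≤ 1/2 ∧
    ∀ X Y T θ θ' φ : ℝ, 0 ≤ X → 0 ≤ Y → X + Y ≤ T → 0 ≤ θ → θ ≤ 1 → 0 ≤ θ' → θ' ≤ 1 →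
      0 ≤ φ → φ ≤ 1 → g ≤ 1 + φ - 2 * θ → g ≤ 1 + φ - 2 * θ' →
      ∀ τ σ : ℂ, ‖τ‖ ≤ r → ‖σ‖ ≤ r →
        T * g / 2 * ‖τ - σ‖ ≤
          ‖(X / (1 + θ * τ) ^ 2 + Y / (1 + θ' * τ) ^ 2 - T / ((1 + τ) * (1 + φ * τ)))
           - (X / (1 + θ * σ) ^ 2 + Y / (1 + θ' * σ) ^ 2 - T / ((1 + σ) * (1 + φ * σ)))‖ := by
  let V : ℂ × ℂ → ℂ := fun p => (2 + p.1 + p.2) / ((1 + p.1) ^ 2 * (1 + p.2) ^ 2)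
  let U1 : ℂ × ℂ × ℂ × ℂ → ℂ := fun p =>
    (1 + p.2.2.1 + p.2.2.2) / ((1 + p.1) * (1 + p.2.1) * (1 + p.2.2.1) * (1 + p.2.2.2))
  let U2 : ℂ × ℂ × ℂ × ℂ → ℂ := fun p =>
    1 / ((1 + p.1) * (1 + p.2.1) * (1 + p.2.2.1) * (1 + p.2.2.2))
  have hV : ContinuousAt V 0 := by
    apply ContinuousAt.div <;> first | fun_prop | simp
  have hU1 : ContinuousAt U1 0 := by
    apply ContinuousAt.div <;> first | fun_prop | simp
  have hU2 : ContinuousAt U2 0 := by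
    apply ContinuousAt.div <;> first | fun_prop | simp
  have he : 0 < g / 6 := by positivity
  obtain ⟨r1, hr1, h1⟩ := Metric.continuousAt_iff.1 hV _ he
  obtain ⟨r2, hr2, h2⟩ := Metric.continuousAt_iff.1 hU1 _ he
  obtain ⟨r3, hr3, h3⟩ := Metric.continuousAt_iff.1 hU2 _ he
  have hV0 : V 0 = 2 := by simp [V]
  have hU10 : U1 0 = 1 := by simp [U1]
  have hU20 : U2 0 = 1 := by simp [U2]
  rw [hV0] at h1; rw [hU10] at h2; rw [hU20] at h3
  let r := min (min (r1/2) (r2/2)) (min (r3/2) (1/2))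
  have hr : 0 < r := by simp only [r]; positivity
  have ra : r < r1 := lt_of_le_of_lt ((min_le_left _ _).trans (min_le_left _ _)) (by linarith)
  have rb : r < r2 := lt_of_le_of_lt ((min_le_left _ _).trans (min_le_right _ _)) (by linarith)
  have rc : r < r3 := lt_of_le_of_lt ((min_le_right _ _).trans (min_le_left _ _)) (by linarith)
  have rd : r ≤ 1/2 := (min_le_right _ _).trans (min_le_right _ _)
  refine ⟨r, hr, rd, ?_⟩
  intro X Y T θ θ' φ hX hY hXY ht0 ht1 hs0 hs1 hp0 hp1 hgt hgs τ σ hτ hσ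
  have small : ∀ (k : ℝ) (w : ℂ), 0 ≤ k → k ≤ 1 → ‖w‖ ≤ r → ‖(k : ℂ) * w‖ ≤ r := by
    intro k w h0 h1 hw
    rw [norm_mul, Complex.norm_real, Real.norm_of_nonneg h0]
    nlinarith [norm_nonneg w]
  have nz : ∀ w : ℂ, ‖w‖ ≤ r → 1 + w ≠ 0 := by
    intro w hw h
    have : w = -1 := by linear_combination h
    rw [this] at hw; norm_num at hw; linarith
  have hVre : ∀ p q : ℂ, ‖p‖ ≤ r → ‖q‖ ≤ r → (V (p, q)).re ≤ 2 + g / 6 := by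
    intro p q hp hq
    have := h1 (x := (p, q)) (by
      rw [dist_zero_right]; exact lt_of_le_of_lt (max_le hp hq) ra)
    rw [dist_eq_norm] at this
    have h := (Complex.abs_re_le_norm _).trans this.le
    have := (abs_le.1 h).2
    simp at this; linarith
  have tθ := small θ τ ht0 ht1 hτ
  have sθ := small θ σ ht0 ht1 hσ
  have tθ' := small θ' τ hs0 hs1 hτ
  have sθ' := small θ' σ hs0 hs1 hσ
  have tφ := small φ τ hp0 hp1 hτ
  have sφ := small φ σ hp0 hp1 hσ
  have hU1re : 1 - g / 6 ≤ (U1 (τ, σ, φ * τ, φ * σ)).re := by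
    have := h2 (x := (τ, σ, φ * τ, φ * σ)) (by
      rw [dist_zero_right]; exact lt_of_le_of_lt (max_le hτ (max_le hσ (max_le tφ sφ))) rb)
    rw [dist_eq_norm] at this
    have h := (Complex.abs_re_le_norm _).trans this.le
    have := (abs_le.1 h).1
    simp at this; linarith
  have hU2re : 1 - g / 6 ≤ (U2 (τ, σ, φ * τ, φ * σ)).re := by
    have := h3 (x := (τ, σ, φ * τ, φ * σ)) (by
      rw [dist_zero_right]; exact lt_of_le_of_lt (max_le hτ (max_le hσ (max_le tφ sφ))) rc)
    rw [dist_eq_norm] at this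
    have h := (Complex.abs_re_le_norm _).trans this.le
    have := (abs_le.1 h).1
    simp at this; linarith
  have hV1 := hVre _ _ tθ sθ
  have hV2 := hVre _ _ tθ' sθ'
  set u1 := U1 (τ, σ, φ * τ, φ * σ) with hu1
  set u2 := U2 (τ, σ, φ * τ, φ * σ) with hu2
  set v1 := V (θ * τ, θ * σ) with hv1
  set v2 := V (θ' * τ, θ' * σ) with hv2
  let Q : ℂ := (T : ℂ) * (u1 + φ * u2) - ((X * θ : ℝ) : ℂ) * v1 - ((Y * θ' : ℝ) : ℂ) * v2
  have n1 := nz _ hτ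
  have n2 := nz _ hσ
  have n3 := nz _ tθ
  have n4 := nz _ sθ
  have n5 := nz _ tθ'
  have n6 := nz _ sθ'
  have n7 := nz _ tφ
  have n8 := nz _ sφ
  have e1 : (X : ℂ) / (1 + θ * τ) ^ 2 - X / (1 + θ * σ) ^ 2 = -(τ - σ) * (((X * θ : ℝ) : ℂ) * v1) := by
    simp only [hv1, V]; push_cast; field_simp; ring
  have e2 : (Y : ℂ) / (1 + θ' * τ) ^ 2 - Y / (1 + θ' * σ) ^ 2 = -(τ - σ) * (((Y * θ' : ℝ) : ℂ) * v2) := by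
    simp only [hv2, V]; push_cast; field_simp; ring
  have e3 : (T : ℂ) / ((1 + τ) * (1 + φ * τ)) - T / ((1 + σ) * (1 + φ * σ))
      = -(τ - σ) * ((T : ℂ) * (u1 + φ * u2)) := by
    simp only [hu1, hu2, U1, U2]
    clear_value u1 u2 v1 v2
    clear e1 e2
    obtain ⟨P, hP⟩ : ∃ P : ℂ, P = φ * τ := ⟨_, rfl⟩
    obtain ⟨P', hP'⟩ : ∃ P : ℂ, P = φ * σ := ⟨_, rfl⟩
    rw [← hP] at n7
    rw [← hP'] at n8
    rw [← hP, ← hP']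
    field_simp
    rw [hP, hP']
    ring
  have hQ : ((X : ℂ) / (1 + θ * τ) ^ 2 + Y / (1 + θ' * τ) ^ 2 - T / ((1 + τ) * (1 + φ * τ)))
           - (X / (1 + θ * σ) ^ 2 + Y / (1 + θ' * σ) ^ 2 - T / ((1 + σ) * (1 + φ * σ)))
           = Q * (τ - σ) := by
    simp only [Q]
    linear_combination e1 + e2 - e3
  rw [hQ, norm_mul]
  apply mul_le_mul_of_nonneg_right _ (norm_nonneg _)
  refine le_trans ?_ (Complex.re_le_norm Q)
  have hre : Q.re = T * (u1.re + φ * u2.re) - X * θ * v1.re - Y * θ' * v2.re := by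
    simp only [Q, Complex.sub_re, Complex.re_ofReal_mul, Complex.add_re]
  rw [hre]
  have hT : 0 ≤ T := by linarith
  have a1 : T * ((1 - g/6) + φ * (1 - g/6)) ≤ T * (u1.re + φ * u2.re) := by gcongr
  have a2 : X * θ * v1.re ≤ X * θ * (2 + g/6) := by gcongr
  have a3 : Y * θ' * v2.re ≤ Y * θ' * (2 + g/6) := by gcongr
  have b1 : X * (2 * θ) ≤ X * (1 + φ - g) := by gcongr; linarith
  have b2 : Y * (2 * θ') ≤ Y * (1 + φ - g) := by gcongr; linarith
  have b3 : (X + Y) * (1 + φ - g) ≤ T * (1 + φ - g) := by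
    apply mul_le_mul_of_nonneg_right hXY; linarith
  have b4 : X * θ ≤ X := by nlinarith
  have b5 : Y * θ' ≤ Y := by nlinarith
  have b6 : (X * θ + Y * θ') * g ≤ T * g := by gcongr; linarith
  have b7 : T * g * φ ≤ T * g := by
    have : 0 ≤ T * g := by positivity
    nlinarith
  linarith

def FF (ρ : ℝ) (z s : ℂ) : ℂ :=
  (z.re : ℂ) ^ 2 / (1 + (1 + ρ) * s) ^ 2 + (z.im : ℂ) ^ 2 / (1 + (1 - ρ) * s) ^ 2 - 1 / (s * (1 + s))

lemma gap_bound (A s : ℝ) (hA0 : 0 < A) (hA2 : A ≤ 2) (hs : 0 < s) :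
    1 / ((1 + s) * (1 + 2 * s)) ≤ 1 + s / (1 + s) - 2 * (A * s / (1 + A * s)) := by
  have h : A * s / (1 + A * s) ≤ 2 * s / (1 + 2 * s) := by
    rw [div_le_div_iff₀ (by positivity) (by positivity)]
    nlinarith
  have : 1 / ((1 + s) * (1 + 2 * s)) = 1 + s / (1 + s) - 2 * (2 * s / (1 + 2 * s)) := by
    field_simp; ring
  linarith

lemma local_bound (ρ : ℝ) (hρ : ρ ∈ Set.Ioo (-1 : ℝ) 1) (S : ℝ) (hS : 0 < S) :
    ∃ r g : ℝ, 0 < r ∧ r ≤ 1/2 ∧ 0 < g ∧ ∀ (z : ℂ) (s t : ℝ), 0 < s → s ≤ S →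
      FF ρ z s = ((-t ^ 2 : ℝ) : ℂ) → ∀ p q : ℂ, ‖p - s‖ ≤ r * s → ‖q - s‖ ≤ r * s →
        g / s * ‖p - q‖ ≤ ‖FF ρ z p - FF ρ z q‖ := by
  obtain ⟨r, hr, hr2, H⟩ := core_bound (1 / ((1 + S) * (1 + 2 * S))) (by positivity)
  refine ⟨r, 1 / (S * (1 + S)) * (1 / ((1 + S) * (1 + 2 * S))) / 2, hr, hr2, by positivity, ?_⟩
  intro z s t hs hsS hF p q hp hq
  have hA : 0 < 1 + ρ := by linarith [hρ.1]
  have hB : 0 < 1 - ρ := by linarith [hρ.2]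
  have hAs : 0 < 1 + (1 + ρ) * s := by positivity
  have hBs : 0 < 1 + (1 - ρ) * s := by positivity
  have h1s : 0 < 1 + s := by positivity
  have hgg : 1 / ((1 + S) * (1 + 2 * S)) ≤ 1 / ((1 + s) * (1 + 2 * s)) := by gcongr
  have hFr : z.re ^ 2 / (1 + (1 + ρ) * s) ^ 2 + z.im ^ 2 / (1 + (1 - ρ) * s) ^ 2 - 1 / (s * (1 + s)) = - t ^ 2 := by
    have := hF
    unfold FF at this
    exact_mod_cast this
  have fr : ∀ k : ℝ, 0 < k → k * s / (1 + k * s) ≤ 1 := by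
    intro k hk
    rw [div_le_one (by positivity)]; linarith
  have h := H (z.re ^ 2 / (1 + (1 + ρ) * s) ^ 2) (z.im ^ 2 / (1 + (1 - ρ) * s) ^ 2) (1 / (s * (1 + s)))
    ((1 + ρ) * s / (1 + (1 + ρ) * s)) ((1 - ρ) * s / (1 + (1 - ρ) * s)) (s / (1 + s))
    (by positivity) (by positivity) (by nlinarith [sq_nonneg t]) (by positivity) (fr _ hA)
    (by positivity) (fr _ hB) (by positivity) (by simpa using fr 1 one_pos)
    (hgg.trans (gap_bound _ _ hA (by linarith [hρ.2]) hs))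
    (hgg.trans (gap_bound _ _ hB (by linarith [hρ.1]) hs))
    ((p - s) / s) ((q - s) / s)
    (by rw [norm_div, Complex.norm_real, Real.norm_of_nonneg hs.le, div_le_iff₀ hs]; exact hp)
    (by rw [norm_div, Complex.norm_real, Real.norm_of_nonneg hs.le, div_le_iff₀ hs]; exact hq)
  have sC : (s : ℂ) ≠ 0 := by exact_mod_cast hs.ne'
  have AC : (1 + (1 + ρ) * s : ℂ) ≠ 0 := by exact_mod_cast hAs.ne'
  have BC : (1 + (1 - ρ) * s : ℂ) ≠ 0 := by exact_mod_cast hBs.ne'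
  have SC : (1 + s : ℂ) ≠ 0 := by exact_mod_cast h1s.ne'
  have key : ∀ p : ℂ, ((z.re ^ 2 / (1 + (1 + ρ) * s) ^ 2 : ℝ) : ℂ) / (1 + (((1 + ρ) * s / (1 + (1 + ρ) * s) : ℝ) : ℂ) * ((p - s) / s)) ^ 2
     + ((z.im ^ 2 / (1 + (1 - ρ) * s) ^ 2 : ℝ) : ℂ) / (1 + (((1 - ρ) * s / (1 + (1 - ρ) * s) : ℝ) : ℂ) * ((p - s) / s)) ^ 2
     - ((1 / (s * (1 + s)) : ℝ) : ℂ) / ((1 + (p - s) / s) * (1 + ((s / (1 + s) : ℝ) : ℂ) * ((p - s) / s))) = FF ρ z p := by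
    intro p
    unfold FF
    push_cast
    have k1 : ∀ k : ℂ, 1 + k * s ≠ 0 → 1 + (k * s / (1 + k * s)) * ((p - s) / s) = (1 + k * p) / (1 + k * s) := by
      intro k hk
      field_simp; ring
    have k2 : 1 + ((s : ℂ) / (1 + s)) * ((p - s) / s) = (1 + p) / (1 + s) := by
      field_simp; ring
    have k3 : 1 + (p - s) / s = p / s := by field_simp; ring
    rw [k1 _ AC, k1 _ BC, k2, k3]
    congr 1
    · congr 1
      · rw [div_pow, div_div_div_cancel_right₀ (pow_ne_zero _ AC)]
      · rw [div_pow, div_div_div_cancel_right₀ (pow_ne_zero _ BC)]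
    · rw [div_mul_div_comm, div_div_div_cancel_right₀ (mul_ne_zero sC SC)]
  rw [key, key] at h
  refine le_trans ?_ h
  have : ‖(p - s) / s - (q - s) / s‖ = ‖p - q‖ / s := by
    rw [← sub_div, norm_div, Complex.norm_real, Real.norm_of_nonneg hs.le]; congr 2; ring
  rw [this]
  have e : 1 / (s * (1 + s)) * (1 / ((1 + S) * (1 + 2 * S))) / 2 * (‖p - q‖ / s)
    = 1 / (s * (1 + s)) * (1 / ((1 + S) * (1 + 2 * S))) / 2 / s * ‖p - q‖ := by ring
  rw [e]
  gcongr

lemma upper_bound (ρ : ℝ) (hρ : ρ ∈ Set.Ioo (-1 : ℝ) 1) (δ : ℝ) (hδ : 0 < δ) :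
    ∃ S : ℝ, 0 < S ∧ ∀ (z : ℂ) (s t : ℝ),
      1 + δ ≤ z.re ^ 2 / (1 + ρ) ^ 2 + z.im ^ 2 / (1 - ρ) ^ 2 → 0 < s →
      FF ρ z s = ((-t ^ 2 : ℝ) : ℂ) → s ≤ S := by
  have hA : 0 < 1 + ρ := by linarith [hρ.1]
  have hB : 0 < 1 - ρ := by linarith [hρ.2]
  obtain ⟨m, hm, hmA, hmB⟩ : ∃ m : ℝ, 0 < m ∧ 1 ≤ m * (1 + ρ) ∧ 1 ≤ m * (1 - ρ) := by
    refine ⟨1 / (1 + ρ) + 1 / (1 - ρ), by positivity, ?_, ?_⟩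
    · rw [add_mul, div_mul_cancel₀ _ hA.ne']; linarith [show 0 < 1 / (1 - ρ) * (1 + ρ) by positivity]
    · rw [add_mul, div_mul_cancel₀ _ hB.ne']; linarith [show 0 < 1 / (1 + ρ) * (1 - ρ) by positivity]
  refine ⟨(2 * m + m ^ 2) / δ + 1, by positivity, ?_⟩
  intro z s t hz hs hF
  have hFr : z.re ^ 2 / (1 + (1 + ρ) * s) ^ 2 + z.im ^ 2 / (1 + (1 - ρ) * s) ^ 2 - 1 / (s * (1 + s)) = - t ^ 2 := by
    have := hF
    unfold FF at this
    exact_mod_cast this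
  have c1 : ∀ (w A : ℝ), 0 < A → 1 ≤ m * A → w ^ 2 / A ^ 2 / (s + m) ^ 2 ≤ w ^ 2 / (1 + A * s) ^ 2 := by
    intro w A hA hmA
    rw [div_div, ← mul_pow]
    gcongr
    nlinarith
  have h1 := c1 z.re _ hA hmA
  have h2 := c1 z.im _ hB hmB
  have h3 : (1 + δ) / (s + m) ^ 2 ≤ 1 / (s * (1 + s)) := by
    have : (1 + δ) / (s + m) ^ 2 ≤ (z.re ^ 2 / (1 + ρ) ^ 2 + z.im ^ 2 / (1 - ρ) ^ 2) / (s + m) ^ 2 := by gcongr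
    rw [add_div (z.re ^ 2 / (1 + ρ) ^ 2)] at this
    nlinarith [sq_nonneg t]
  rw [div_le_div_iff₀ (by positivity) (by positivity)] at h3
  by_contra hcon
  push Not at hcon
  have h4 : (2 * m + m ^ 2) < (s - 1) * δ := by
    rw [← div_lt_iff₀ hδ]; linarith
  have h5 : 1 < s := by
    have : 0 < (2 * m + m ^ 2) / δ := by positivity
    linarith
  nlinarith [mul_pos hs hδ, mul_pos hm hm]

lemma outside (ρ : ℝ) (hρ : ρ ∈ Set.Ioo (-1 : ℝ) 1) (δ : ℝ) (hδ : 0 < δ) (z : ℂ)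
    (E : Set ℂ) (hE : E = {z : ℂ | z.re ^ 2 / (1 + ρ) ^ 2 + z.im ^ 2 / (1 - ρ) ^ 2 ≤ 1})
    (hz : δ ≤ Metric.infDist z E) :
      1 + δ ≤ z.re ^ 2 / (1 + ρ) ^ 2 + z.im ^ 2 / (1 - ρ) ^ 2 := by
  have hA : 0 < 1 + ρ := by linarith [hρ.1]
  have hB : 0 < 1 - ρ := by linarith [hρ.2]
  set W := z.re ^ 2 / (1 + ρ) ^ 2 + z.im ^ 2 / (1 - ρ) ^ 2 with hW
  have hW1 : 1 < W := by
    by_contra h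
    push Not at h
    have : z ∈ E := by rw [hE]; exact h
    rw [Metric.infDist_zero_of_mem this] at hz
    linarith
  set R := Real.sqrt W with hR
  have hR2 : R ^ 2 = W := Real.sq_sqrt (by linarith)
  have hR1 : 1 < R := by
    rw [hR, Real.lt_sqrt] <;> linarith
  have hR0 : 0 < R := by linarith
  have hmem : z / (R : ℂ) ∈ E := by
    rw [hE]
    show (z / (R : ℂ)).re ^ 2 / (1 + ρ) ^ 2 + (z / (R : ℂ)).im ^ 2 / (1 - ρ) ^ 2 ≤ 1
    rw [Complex.div_ofReal_re, Complex.div_ofReal_im]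
    have : (z.re / R) ^ 2 / (1 + ρ) ^ 2 + (z.im / R) ^ 2 / (1 - ρ) ^ 2 = W / R ^ 2 := by
      rw [hW]; field_simp
    rw [this, hR2, div_self (by linarith)]
  have h1 : δ ≤ dist z (z / (R : ℂ)) := hz.trans (Metric.infDist_le_dist_of_mem hmem)
  have h2 : dist z (z / (R : ℂ)) = ‖z‖ * (1 - 1 / R) := by
    have : z - z / (R : ℂ) = z * ((1 - 1 / R : ℝ) : ℂ) := by push_cast; ring
    rw [dist_eq_norm, this, norm_mul, Complex.norm_real, Real.norm_of_nonneg]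
    rw [sub_nonneg, div_le_one hR0]; exact hR1.le
  have h3 : ‖z‖ ≤ 2 * R := by
    apply le_of_sq_le_sq _ (by positivity)
    rw [Complex.sq_norm, Complex.normSq_apply, mul_pow, hR2, hW]
    have q1 : z.re ^ 2 ≤ 4 * (z.re ^ 2 / (1 + ρ) ^ 2) := by
      rw [mul_div_assoc', le_div_iff₀ (by positivity)]
      nlinarith [sq_nonneg z.re, hρ.1, hρ.2, mul_nonneg (sq_nonneg z.re) (show 0 ≤ 4 - (1+ρ)^2 by nlinarith [hρ.1, hρ.2])]
    have q2 : z.im ^ 2 ≤ 4 * (z.im ^ 2 / (1 - ρ) ^ 2) := by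
      rw [mul_div_assoc', le_div_iff₀ (by positivity)]
      nlinarith [mul_nonneg (sq_nonneg z.im) (show 0 ≤ 4 - (1-ρ)^2 by nlinarith [hρ.1, hρ.2])]
    nlinarith
  have h4 : ‖z‖ * (1 - 1 / R) ≤ 2 * R * (1 - 1 / R) := by
    gcongr
    rw [sub_nonneg, div_le_one hR0]; exact hR1.le
  have h5 : 2 * R * (1 - 1 / R) = 2 * (R - 1) := by field_simp
  nlinarith

lemma kern_norm (η : ℂ) (hη : 0 < η.im) (u : ℝ) : ‖((u : ℂ) - η)⁻¹‖ ≤ 1 / η.im := by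
  rw [norm_inv, ← one_div]
  apply one_div_le_one_div_of_le hη
  have := Complex.abs_im_le_norm ((u : ℂ) - η)
  simp at this
  rwa [abs_of_pos hη] at this

lemma kern_meas (η : ℂ) (ν : Measure ℝ) : AEStronglyMeasurable (fun u : ℝ => ((u : ℂ) - η)⁻¹) ν := by
  apply Measurable.aestronglyMeasurable
  fun_prop

lemma kern_int (ν : Measure ℝ) [IsProbabilityMeasure ν] (η : ℂ) (hη : 0 < η.im) :
    Integrable (fun u : ℝ => ((u : ℂ) - η)⁻¹) ν :=
  Integrable.of_bound (kern_meas η ν) (1 / η.im) (Filter.Eventually.of_forall (kern_norm η hη))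

lemma st_norm (ν : Measure ℝ) [IsProbabilityMeasure ν] (η : ℂ) (hη : 0 < η.im) :
    ‖stieltjes ν η‖ ≤ 1 / η.im := by
  have := norm_integral_le_of_norm_le_const (μ := ν) (Filter.Eventually.of_forall (kern_norm η hη))
  simpa [stieltjes] using this

lemma st_cont (ν : Measure ℝ) [IsProbabilityMeasure ν] (η : ℂ) (hη : 0 < η.im) :
    ContinuousAt (stieltjes ν) η := by
  unfold stieltjes
  apply continuousAt_of_dominated (bound := fun _ => 1 / (η.im / 2))
  · exact Filter.Eventually.of_forall fun w => kern_meas w ν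
  · have : ∀ᶠ w : ℂ in nhds η, η.im / 2 < w.im :=
      (Complex.continuous_im.continuousAt).eventually_const_lt (by linarith)
    filter_upwards [this] with w hw
    refine Filter.Eventually.of_forall fun u => (kern_norm w (by linarith) u).trans ?_
    exact one_div_le_one_div_of_le (by linarith) hw.le
  · exact integrable_const _
  · refine Filter.Eventually.of_forall fun u => ?_
    apply ContinuousAt.inv₀
    · fun_prop
    · intro h
      have := congrArg Complex.im h
      simp at this
      linarith

lemma kern_im (η : ℂ) (u : ℝ) :
    (((u : ℂ) - η)⁻¹).im = η.im / ((u - η.re) ^ 2 + η.im ^ 2) := by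
  rw [Complex.inv_im, Complex.normSq_apply]
  simp
  ring_nf

lemma st_im (ν : Measure ℝ) [IsProbabilityMeasure ν] (η : ℂ) (hη : 0 < η.im) :
    (stieltjes ν η).im = ∫ u : ℝ, η.im / ((u - η.re) ^ 2 + η.im ^ 2) ∂ν := by
  unfold stieltjes
  have := Complex.imCLM.integral_comp_comm (kern_int ν η hη)
  simp only [Complex.imCLM_apply] at this
  rw [← this]
  simp_rw [kern_im]

lemma kern_im_int (ν : Measure ℝ) [IsProbabilityMeasure ν] (η : ℂ) (hη : 0 < η.im) :
    Integrable (fun u : ℝ => η.im / ((u - η.re) ^ 2 + η.im ^ 2)) ν := by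
  have := Complex.imCLM.integrable_comp (kern_int ν η hη)
  simpa only [Complex.imCLM_apply, kern_im] using this

lemma st_im_pos (ν : Measure ℝ) [IsProbabilityMeasure ν] (η : ℂ) (hη : 0 < η.im) :
    0 < (stieltjes ν η).im := by
  rw [st_im ν η hη, integral_pos_iff_support_of_nonneg (fun u => by positivity) (kern_im_int ν η hη)]
  have : (Function.support fun u : ℝ => η.im / ((u - η.re) ^ 2 + η.im ^ 2)) = Set.univ := by
    ext u
    have : η.im / ((u - η.re) ^ 2 + η.im ^ 2) ≠ 0 := by positivity
    simpa using this
  rw [this]; simp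

lemma st_interval (ν : Measure ℝ) [IsProbabilityMeasure ν] (E e : ℝ) (he : 0 < e) :
    ν.real (Set.Icc (E - e) (E + e)) ≤ 2 * e * (stieltjes ν (E + e * Complex.I)).im := by
  have hi : ((E : ℂ) + e * Complex.I).im = e := by simp
  have hr : ((E : ℂ) + e * Complex.I).re = E := by simp
  have hη : 0 < ((E : ℂ) + e * Complex.I).im := by rw [hi]; exact he
  rw [st_im ν _ hη]
  have h2 := kern_im_int ν _ hη
  rw [hi, hr] at *
  have h1 : ∫ u, (Set.Icc (E - e) (E + e)).indicator (fun _ => 1 / (2 * e)) u ∂ν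
      ≤ ∫ u : ℝ, e / ((u - E) ^ 2 + e ^ 2) ∂ν := by
    apply integral_mono _ h2
    · intro u
      by_cases hu : u ∈ Set.Icc (E - e) (E + e)
      · rw [Set.indicator_of_mem hu]
        show 1 / (2 * e) ≤ e / ((u - E) ^ 2 + e ^ 2)
        rw [div_le_div_iff₀ (by positivity) (by positivity)]
        have := hu.1
        have := hu.2
        nlinarith
      · rw [Set.indicator_of_notMem hu]
        show 0 ≤ e / ((u - E) ^ 2 + e ^ 2)
        positivity
    · exact (integrable_const _).indicator measurableSet_Icc
  rw [integral_indicator_const _ measurableSet_Icc, smul_eq_mul] at h1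
  have : ν.real (Set.Icc (E - e) (E + e)) = 2 * e * (ν.real (Set.Icc (E - e) (E + e)) * (1 / (2 * e))) := by
    field_simp
  rw [this]
  gcongr

lemma null_of_quad (ν : Measure ℝ) [IsProbabilityMeasure ν] (c K : ℝ) (hc : 0 < c)
    (h : ∀ e E : ℝ, 0 < e → e ≤ c → |E| ≤ c → ν.real (Set.Icc (E - e) (E + e)) ≤ K * e ^ 2) :
    ν (Set.Icc (-c) c) = 0 := by
  have hb : ∀ n : ℕ, ν.real (Set.Icc (-c) c) ≤ (n + 3) * (K * (2 * c / (n + 2)) ^ 2) := by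
    intro n
    have hn : (0 : ℝ) < n + 2 := by positivity
    have hsub : Set.Icc (-c) c ⊆ ⋃ k ∈ Finset.range (n + 3),
        Set.Icc ((-c + 2 * c * (k : ℝ) / (n + 2)) - 2 * c / (n + 2)) ((-c + 2 * c * (k : ℝ) / (n + 2)) + 2 * c / (n + 2)) := by
      intro u hu
      have h0 : 0 ≤ (u + c) * (n + 2) / (2 * c) := by
        have := hu.1
        apply div_nonneg (mul_nonneg (by linarith) hn.le) (by linarith)
      have hk1 := Nat.floor_le h0
      have hk2 := Nat.lt_floor_add_one ((u + c) * (n + 2) / (2 * c))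
      set k := ⌊(u + c) * (n + 2) / (2 * c)⌋₊ with hk
      have hkn : (k : ℝ) ≤ n + 2 := by
        refine hk1.trans ?_
        rw [div_le_iff₀ (by positivity)]
        nlinarith [hu.2]
      have hkn' : k < n + 3 := by
        have : k ≤ n + 2 := by exact_mod_cast hkn
        omega
      simp only [Set.mem_iUnion, Finset.mem_range]
      refine ⟨k, hkn', ?_⟩
      rw [le_div_iff₀ (by positivity)] at hk1
      rw [div_lt_iff₀ (by positivity)] at hk2
      have q0 : 0 < 2 * c / (n + 2) := by positivity
      have q1 : 2 * c * k / (n + 2) ≤ u + c := by rw [div_le_iff₀ hn]; linarith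
      have q2 : u + c ≤ 2 * c * k / (n + 2) + 2 * c / (n + 2) := by
        rw [← add_div, le_div_iff₀ hn]; linarith
      constructor <;> linarith
    calc ν.real (Set.Icc (-c) c) ≤ ν.real (⋃ k ∈ Finset.range (n + 3),
        Set.Icc ((-c + 2 * c * (k : ℝ) / (n + 2)) - 2 * c / (n + 2)) ((-c + 2 * c * (k : ℝ) / (n + 2)) + 2 * c / (n + 2))) :=
          measureReal_mono hsub (measure_ne_top _ _)
      _ ≤ ∑ k ∈ Finset.range (n + 3), ν.real (Set.Icc ((-c + 2 * c * (k : ℝ) / (n + 2)) - 2 * c / (n + 2)) ((-c + 2 * c * (k : ℝ) / (n + 2)) + 2 * c / (n + 2))) :=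
          measureReal_biUnion_finset_le _ _
      _ ≤ ∑ k ∈ Finset.range (n + 3), K * (2 * c / (n + 2)) ^ 2 := by
          apply Finset.sum_le_sum
          intro k hk
          apply h _ _ (by positivity)
          · rw [div_le_iff₀ hn]; nlinarith [show (0:ℝ) ≤ n from Nat.cast_nonneg n]
          · have hk' : (k : ℝ) ≤ n + 2 := by
              have := Finset.mem_range.1 hk
              have : k ≤ n + 2 := by omega
              exact_mod_cast this
            have q1 : 2 * c * k / (n + 2) ≤ 2 * c := by rw [div_le_iff₀ hn]; nlinarith
            have q2 : 0 ≤ 2 * c * k / (n + 2) := by positivity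
            rw [abs_le]; constructor <;> linarith
      _ = (n + 3) * (K * (2 * c / (n + 2)) ^ 2) := by
          rw [Finset.sum_const, Finset.card_range, nsmul_eq_mul]; push_cast; ring
  have hlim : Filter.Tendsto (fun n : ℕ => ((n : ℝ) + 3) * (K * (2 * c / (n + 2)) ^ 2)) Filter.atTop (nhds 0) := by
    have h1 : Filter.Tendsto (fun n : ℕ => (1 : ℝ) / ((n : ℝ) + 2)) Filter.atTop (nhds 0) := by
      simp_rw [one_div]
      exact (Filter.tendsto_atTop_add_const_right _ _ tendsto_natCast_atTop_atTop).inv_tendsto_atTop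
    have h2 : Filter.Tendsto (fun n : ℕ => 4 * K * c ^ 2 * ((1 : ℝ) / ((n : ℝ) + 2) + (1 / ((n : ℝ) + 2)) ^ 2)) Filter.atTop
        (nhds (4 * K * c ^ 2 * (0 + 0 ^ 2))) := (h1.add (h1.pow 2)).const_mul _
    simp only [ne_eq, OfNat.ofNat_ne_zero, not_false_eq_true, zero_pow, add_zero, mul_zero] at h2
    refine h2.congr fun n => ?_
    have hn : (n : ℝ) + 2 ≠ 0 := by positivity
    field_simp
    ring
  have h0 : ν.real (Set.Icc (-c) c) ≤ 0 := ge_of_tendsto' hlim hb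
  have h1 : ν.real (Set.Icc (-c) c) = 0 := le_antisymm h0 measureReal_nonneg
  rwa [measureReal_eq_zero_iff] at h1

lemma FF_conj (ρ : ℝ) (z s : ℂ) : FF ρ z (starRingEnd ℂ s) = starRingEnd ℂ (FF ρ z s) := by
  simp [FF]

lemma st_FF (ρ : ℝ) (z : ℂ) (ν : Measure ℝ) (h : SelfConsistent ρ z ν) (η : ℂ) (hη : 0 < η.im) :
    FF ρ z (stieltjes ν η / η) = η ^ 2 := by
  have h1 := h η hη
  have hne : η ≠ 0 := by rintro rfl; simp at hη
  set a := stieltjes ν η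
  obtain ⟨s, hs⟩ : ∃ s, s = a / η := ⟨_, rfl⟩
  have ha : a = s * η := by rw [hs]; field_simp
  rw [← hs, FF]
  rw [ha] at h1
  have e1 : 1 / (s * η * (η + s * η)) = 1 / (s * (1 + s)) / η ^ 2 := by
    rw [div_div]; congr 1; ring
  have e2 : ∀ w k : ℂ, w ^ 2 / (η + k * (s * η)) ^ 2 = w ^ 2 / (1 + k * s) ^ 2 / η ^ 2 := by
    intro w k
    rw [div_div]; congr 1; ring
  rw [e1, e2, e2] at h1
  have hne2 : η ^ 2 ≠ 0 := pow_ne_zero _ hne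
  generalize 1 / (s * (1 + s)) = α at *
  generalize (z.re : ℂ) ^ 2 / (1 + (1 + ρ) * s) ^ 2 = β at *
  generalize (z.im : ℂ) ^ 2 / (1 + (1 - ρ) * s) ^ 2 = γ at *
  field_simp at h1
  linear_combination -h1

lemma near_zero (ρ : ℝ) (hρ : ρ ∈ Set.Ioo (-1 : ℝ) 1) (z : ℂ) :
    ∃ ε : ℝ, 0 < ε ∧ ∀ s t : ℂ, s ≠ 0 → t ≠ 0 → ‖s‖ < ε → ‖t‖ < ε → FF ρ z s = FF ρ z t → s = t := by
  let K : ℂ × ℂ → ℂ := fun p => 1 + p.1 + p.2 - p.1 * p.2 * (1 + p.1) * (1 + p.2) *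
    ((z.re : ℂ) ^ 2 * (1 + ρ) * (2 + (1 + ρ) * p.1 + (1 + ρ) * p.2) / ((1 + (1 + ρ) * p.1) ^ 2 * (1 + (1 + ρ) * p.2) ^ 2)
    + (z.im : ℂ) ^ 2 * (1 - ρ) * (2 + (1 - ρ) * p.1 + (1 - ρ) * p.2) / ((1 + (1 - ρ) * p.1) ^ 2 * (1 + (1 - ρ) * p.2) ^ 2))
  have hK : ContinuousAt K 0 := by
    apply ContinuousAt.sub (by fun_prop)
    apply ContinuousAt.mul (by fun_prop)
    apply ContinuousAt.add
    · apply ContinuousAt.div <;> first | fun_prop | simp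
    · apply ContinuousAt.div <;> first | fun_prop | simp
  have hK0 : K 0 ≠ 0 := by simp [K]
  have hev := hK.eventually_ne hK0
  obtain ⟨ε, hε, H⟩ := Metric.eventually_nhds_iff.1 hev
  refine ⟨min ε (1/2), by positivity, ?_⟩
  intro s t hs ht hse hte hF
  have hKst : K (s, t) ≠ 0 := H (by
    rw [dist_zero_right]
    exact max_lt (hse.trans_le (min_le_left _ _)) (hte.trans_le (min_le_left _ _)))
  have nz : ∀ (k : ℝ) (w : ℂ), |k| ≤ 2 → ‖w‖ < min ε (1/2) → 1 + (k : ℂ) * w ≠ 0 := by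
    intro k w hk hw h
    have h1 : (k : ℂ) * w = -1 := by linear_combination h
    have h2 : |k| * ‖w‖ = 1 := by
      have := congrArg norm h1
      rwa [norm_mul, Complex.norm_real, norm_neg, norm_one] at this
    have h3 := hw.trans_le (min_le_right _ _)
    nlinarith [norm_nonneg w]
  have hA : |1 + ρ| ≤ 2 := by rw [abs_le]; constructor <;> linarith [hρ.1, hρ.2]
  have hB : |1 - ρ| ≤ 2 := by rw [abs_le]; constructor <;> linarith [hρ.1, hρ.2]
  have h1 : |(1:ℝ)| ≤ 2 := by norm_num
  have a1 := nz _ s hA hse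
  have a2 := nz _ t hA hte
  have a3 := nz _ s hB hse
  have a4 := nz _ t hB hte
  have a5 := nz _ s h1 hse
  have a6 := nz _ t h1 hte
  push_cast at a1 a2 a3 a4 a5 a6
  rw [one_mul] at a5 a6
  have key : ∀ x k : ℂ, 1 + k * s ≠ 0 → 1 + k * t ≠ 0 →
      x ^ 2 / (1 + k * s) ^ 2 - x ^ 2 / (1 + k * t) ^ 2 = -(s - t) * (x ^ 2 * k * (2 + k * s + k * t) / ((1 + k * s) ^ 2 * (1 + k * t) ^ 2)) := by
    intro x k b1 b2
    field_simp
    ring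
  have key2 : 1 / (s * (1 + s)) - 1 / (t * (1 + t)) = -(s - t) * ((1 + s + t) / (s * t * (1 + s) * (1 + t))) := by
    field_simp
    ring
  have e1 := key z.re _ a1 a2
  have e2 := key z.im _ a3 a4
  have e3 : FF ρ z s - FF ρ z t = (s - t) * (K (s, t) / (s * t * (1 + s) * (1 + t))) := by
    have hd : s * t * (1 + s) * (1 + t) ≠ 0 := by positivity
    simp only [FF, K]
    rw [sub_div (1 + s + t), mul_div_cancel_left₀ _ hd]
    linear_combination e1 + e2 - key2
  rw [hF, sub_self] at e3
  rcases mul_eq_zero.1 e3.symm with h | h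
  · exact sub_eq_zero.1 h
  · exfalso
    have hd : s * t * (1 + s) * (1 + t) ≠ 0 := by positivity
    exact (div_ne_zero hKst hd) h

lemma axis_real (ρ : ℝ) (hρ : ρ ∈ Set.Ioo (-1 : ℝ) 1) (z : ℂ) (r g S : ℝ) (hr : 0 < r) (hg : 0 < g)
    (hloc : ∀ (s t : ℝ), 0 < s → s ≤ S →
      FF ρ z s = ((-t ^ 2 : ℝ) : ℂ) → ∀ p q : ℂ, ‖p - s‖ ≤ r * s → ‖q - s‖ ≤ r * s →
        g / s * ‖p - q‖ ≤ ‖FF ρ z p - FF ρ z q‖)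
    (hup : ∀ s t : ℝ, 0 < s → FF ρ z s = ((-t ^ 2 : ℝ) : ℂ) → s ≤ S)
    (s : ℂ → ℂ) (hc : ∀ η : ℂ, 0 < η.im → ContinuousAt s η)
    (hF : ∀ η : ℂ, 0 < η.im → FF ρ z (s η) = η ^ 2)
    (hpos : ∀ η : ℂ, 0 < η.im → (s η).im = 0 → 0 < (s η).re)
    (hn : ∀ η : ℂ, 0 < η.im → ‖s η‖ ≤ 1 / η.im ^ 2) (t : ℝ) (ht : 0 < t) :
    (s (t * Complex.I)).im = 0 := by
  have him : ∀ t : ℝ, ((t : ℂ) * Complex.I).im = t := by intro t; simp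
  have hsq : ∀ t : ℝ, ((t : ℂ) * Complex.I) ^ 2 = ((-t ^ 2 : ℝ) : ℂ) := by
    intro t; rw [mul_pow, Complex.I_sq]; push_cast; ring
  let f : ℝ → ℂ := fun x => s ((Real.exp x : ℝ) * Complex.I)
  have hfc : Continuous f := by
    rw [continuous_iff_continuousAt]
    intro x
    have : ContinuousAt (fun x : ℝ => ((Real.exp x : ℝ) : ℂ) * Complex.I) x := by fun_prop
    exact ContinuousAt.comp (f := fun x : ℝ => ((Real.exp x : ℝ) : ℂ) * Complex.I) (g := s)
      (hc _ (by rw [him]; exact Real.exp_pos x)) this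
  have hfF : ∀ x, FF ρ z (f x) = ((-(Real.exp x) ^ 2 : ℝ) : ℂ) := by
    intro x
    rw [← hsq]
    exact hF _ (by rw [him]; exact Real.exp_pos x)
  have hconj : ∀ x, FF ρ z (f x) = FF ρ z (starRingEnd ℂ (f x)) := by
    intro x
    rw [FF_conj, hfF, Complex.conj_ofReal]
  have hcl : IsClopen {x : ℝ | (f x).im = 0} := by
    constructor
    · exact isClosed_eq (by fun_prop) continuous_const
    · rw [isOpen_iff_mem_nhds]
      intro x hx
      have hx : (f x).im = 0 := hx
      have hp : 0 < (f x).re := hpos _ (by rw [him]; exact Real.exp_pos x) hx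
      have hre : f x = ((f x).re : ℂ) := Complex.ext (by simp) (by simpa using hx)
      have hFx := hfF x
      rw [hre] at hFx
      have hle := hup _ _ hp hFx
      have hL := hloc _ _ hp hle hFx
      have hev : ∀ᶠ y in nhds x, f y ∈ Metric.ball (f x) (r * (f x).re) :=
        hfc.continuousAt (Metric.ball_mem_nhds _ (by positivity))
      filter_upwards [hev] with y hy
      rw [Metric.mem_ball, dist_eq_norm, hre, Complex.ofReal_re] at hy
      have hy2 : ‖starRingEnd ℂ (f y) - ((f x).re : ℂ)‖ ≤ r * (f x).re := by
        rw [← Complex.conj_ofReal, ← map_sub, Complex.norm_conj]; exact hy.le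
      have := hL _ _ hy.le hy2
      rw [← hconj, sub_self, norm_zero] at this
      have h0 : ‖f y - starRingEnd ℂ (f y)‖ ≤ 0 := by
        by_contra hcon
        push Not at hcon
        have : 0 < g / (f x).re * ‖f y - starRingEnd ℂ (f y)‖ := by positivity
        linarith
      have h1 : f y = starRingEnd ℂ (f y) := sub_eq_zero.1 (norm_le_zero_iff.1 h0)
      exact Complex.conj_eq_iff_im.1 h1.symm
  have hne : {x : ℝ | (f x).im = 0}.Nonempty := by
    obtain ⟨ε, hε, H⟩ := near_zero ρ hρ z
    have hlim : Filter.Tendsto (fun x : ℝ => 1 / Real.exp x ^ 2) Filter.atTop (nhds 0) := by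
      simp_rw [one_div]
      exact ((Filter.tendsto_pow_atTop two_ne_zero).comp Real.tendsto_exp_atTop).inv_tendsto_atTop
    obtain ⟨x, hx⟩ := (hlim.eventually_lt_const hε).exists
    refine ⟨x, ?_⟩
    show (f x).im = 0
    have him0 : 0 < (((Real.exp x : ℝ) : ℂ) * Complex.I).im := by rw [him]; exact Real.exp_pos x
    have hnx := hn _ him0
    rw [him] at hnx
    have hlt : ‖f x‖ < ε := hnx.trans_lt hx
    have h0 : f x ≠ 0 := by
      intro h
      have := hpos _ him0 (by show (f x).im = 0; rw [h]; simp)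
      change 0 < (f x).re at this
      rw [h] at this; simp at this
    have := H (f x) (starRingEnd ℂ (f x)) h0 (by simpa using h0) hlt (by rwa [Complex.norm_conj]) (hconj x)
    exact Complex.conj_eq_iff_im.1 this.symm
  have huniv := hcl.eq_univ hne
  have : Real.log t ∈ {x : ℝ | (f x).im = 0} := by rw [huniv]; trivial
  have h : (f (Real.log t)).im = 0 := this
  simpa only [f, Real.exp_log ht] using h

lemma strip_bound (ρ : ℝ) (z : ℂ) (r g S c : ℝ) (hr : 0 < r) (hr2 : r ≤ 1/2) (hg : 0 < g)
    (hc1 : 3 * c ^ 2 < g * r)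
    (hloc : ∀ (s t : ℝ), 0 < s → s ≤ S →
      FF ρ z s = ((-t ^ 2 : ℝ) : ℂ) → ∀ p q : ℂ, ‖p - s‖ ≤ r * s → ‖q - s‖ ≤ r * s →
        g / s * ‖p - q‖ ≤ ‖FF ρ z p - FF ρ z q‖)
    (hup : ∀ s t : ℝ, 0 < s → FF ρ z s = ((-t ^ 2 : ℝ) : ℂ) → s ≤ S)
    (s : ℂ → ℂ) (hc : ∀ η : ℂ, 0 < η.im → ContinuousAt s η)
    (hF : ∀ η : ℂ, 0 < η.im → FF ρ z (s η) = η ^ 2)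
    (hpos : ∀ η : ℂ, 0 < η.im → (s η).im = 0 → 0 < (s η).re)
    (hax : ∀ t : ℝ, 0 < t → (s (t * Complex.I)).im = 0)
    (e E : ℝ) (he : 0 < e) (hec : e ≤ c) (hE : |E| ≤ c) :
    (s (E + e * Complex.I) * (E + e * Complex.I)).im ≤ (2 * S + 2 * c ^ 2 * S / g) * e := by
  have hc0 : 0 < c := he.trans_le hec
  have him : ∀ E : ℝ, ((E : ℂ) + e * Complex.I).im = e := by intro t; simp
  have him0 : ∀ E : ℝ, 0 < ((E : ℂ) + e * Complex.I).im := by intro t; rw [him]; exact he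
  let f : ℝ → ℂ := fun E => s (E + e * Complex.I)
  have hfc : Continuous f := by
    rw [continuous_iff_continuousAt]
    intro x
    have : ContinuousAt (fun x : ℝ => (x : ℂ) + e * Complex.I) x := by fun_prop
    exact ContinuousAt.comp (f := fun x : ℝ => (x : ℂ) + e * Complex.I) (g := s) (hc _ (him0 x)) this
  have hf0 : (f 0).im = 0 := by simpa [f] using hax e he
  have hp : 0 < (f 0).re := hpos _ (him0 0) hf0
  obtain ⟨s0, hs0⟩ : ∃ s0 : ℝ, s0 = (f 0).re := ⟨_, rfl⟩
  have hre : f 0 = (s0 : ℂ) := by rw [hs0]; exact Complex.ext (by simp) (by simpa using hf0)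
  rw [← hs0] at hp
  have hfF : ∀ x : ℝ, FF ρ z (f x) = ((x : ℂ) + e * Complex.I) ^ 2 := fun x => hF _ (him0 x)
  have hF0 : FF ρ z (s0 : ℂ) = ((-e ^ 2 : ℝ) : ℂ) := by
    rw [← hre, hfF, Complex.ofReal_zero, zero_add, mul_pow, Complex.I_sq]; push_cast; ring
  have hle := hup _ _ hp hF0
  have hL := hloc _ _ hp hle hF0
  have hball : ‖f E - s0‖ ≤ r * s0 := by
    by_contra hcon
    push Not at hcon
    have hpc : IsPreconnected (Set.Icc (-c) c) := isPreconnected_Icc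
    have hcont : ContinuousOn (fun x => ‖f x - s0‖) (Set.Icc (-c) c) := by fun_prop
    have hsub := hpc.intermediate_value (a := 0) (b := E) ⟨by linarith, by linarith⟩ (abs_le.1 hE) hcont
    obtain ⟨x, hx, hxe⟩ := hsub (show r * s0 ∈ _ from ⟨by simp only [hre, sub_self, norm_zero]; positivity, hcon.le⟩)
    have hxe : ‖f x - s0‖ = r * s0 := hxe
    have h1 := hL (f x) s0 hxe.le (by simp; positivity)
    rw [hxe, hfF, hF0] at h1
    have h2 : ((x : ℂ) + e * Complex.I) ^ 2 - ((-e ^ 2 : ℝ) : ℂ) = (x : ℂ) * (x + 2 * e * Complex.I) := by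
      push_cast
      linear_combination (e : ℂ) ^ 2 * Complex.I_sq
    have hxa : |x| ≤ c := abs_le.2 hx
    have h3 : ‖(x : ℂ) * (x + 2 * e * Complex.I)‖ ≤ 3 * c ^ 2 := by
      rw [norm_mul, Complex.norm_real, Real.norm_eq_abs]
      have : ‖(x : ℂ) + 2 * e * Complex.I‖ ≤ c + 2 * c := by
        refine (norm_add_le _ _).trans ?_
        simp [abs_of_pos he]
        linarith
      nlinarith [abs_nonneg x, norm_nonneg ((x : ℂ) + 2 * e * Complex.I)]
    rw [h2] at h1
    have h4 : g / s0 * (r * s0) = g * r := by field_simp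
    linarith
  have hball2 : ‖starRingEnd ℂ (f E) - s0‖ ≤ r * s0 := by
    rw [← Complex.conj_ofReal, ← map_sub, Complex.norm_conj]; exact hball
  have h1 := hL _ _ hball hball2
  rw [FF_conj, hfF] at h1
  have h2 : ((E : ℂ) + e * Complex.I) ^ 2 - starRingEnd ℂ (((E : ℂ) + e * Complex.I) ^ 2) = 4 * E * e * Complex.I := by
    simp; ring
  rw [h2, Complex.sub_conj] at h1
  have h3 : ‖(4 : ℂ) * E * e * Complex.I‖ = 4 * |E| * e := by
    simp [abs_of_pos he]
  have h4 : ‖((2 * (f E).im : ℝ) : ℂ) * Complex.I‖ = 2 * |(f E).im| := by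
    simp
  rw [h3, h4] at h1
  have h5 : |(f E).im| ≤ 2 * c * e * S / g := by
    rw [le_div_iff₀ hg]
    rw [div_mul_eq_mul_div, div_le_iff₀ hp] at h1
    have : |E| * e * s0 ≤ c * e * S := by gcongr
    linarith
  have h6 : (f E).re ≤ 2 * S := by
    have := (Complex.re_le_norm _).trans hball
    simp at this
    nlinarith
  have h7 : (s (E + e * Complex.I) * (E + e * Complex.I)).im = (f E).re * e + (f E).im * E := by
    simp [f]
  rw [h7]
  have h8 : (f E).im * E ≤ 2 * c * e * S / g * c := by
    refine (le_abs_self _).trans ?_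
    rw [abs_mul]
    exact mul_le_mul h5 hE (abs_nonneg _) ((abs_nonneg _).trans h5)
  have h9 : (f E).re * e ≤ 2 * S * e := by gcongr
  have h10 : 2 * c * e * S / g * c = 2 * c ^ 2 * S / g * e := by ring
  rw [add_mul]; linarith

theorem stmt19 (ρ : ℝ) (hρ : ρ ∈ Set.Ioo (-1 : ℝ) 1) (δ : ℝ) (hδ : 0 < δ) :
    ∃ c : ℝ, 0 < c ∧
      ∀ z : ℂ, δ ≤ Metric.infDist z (ellipse ρ) →
        ∀ ν : Measure ℝ, IsProbabilityMeasure ν → SelfConsistent ρ z ν →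
          ν (Set.Icc (-c) c) = 0 := by
  have hell : ellipse ρ = {z : ℂ | z.re ^ 2 / (1 + ρ) ^ 2 + z.im ^ 2 / (1 - ρ) ^ 2 ≤ 1} := by
    rw [ellipse, if_neg hρ.2.ne, if_neg hρ.1.ne']
  obtain ⟨S, hS, hup⟩ := upper_bound ρ hρ δ hδ
  obtain ⟨r, g, hr, hr2, hg, hloc⟩ := local_bound ρ hρ S hS
  have hgr : 0 < g * r := mul_pos hg hr
  refine ⟨min 1 (g * r / 6), by positivity, ?_⟩
  have hc0 : 0 < min 1 (g * r / 6) := by positivity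
  have hc1 : min 1 (g * r / 6) ≤ 1 := min_le_left _ _
  have hc2 : min 1 (g * r / 6) ≤ g * r / 6 := min_le_right _ _
  generalize min 1 (g * r / 6) = c at *
  intro z hz ν hν hsc
  have hout := outside ρ hρ δ hδ z _ hell hz
  have hup' : ∀ s t : ℝ, 0 < s → FF ρ z s = ((-t ^ 2 : ℝ) : ℂ) → s ≤ S :=
    fun s t h1 h2 => hup z s t hout h1 h2
  have hne : ∀ η : ℂ, 0 < η.im → η ≠ 0 := by
    rintro η hη rfl; simp at hη
  let s : ℂ → ℂ := fun η => stieltjes ν η / η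
  have hsc' : ∀ η : ℂ, 0 < η.im → ContinuousAt s η := fun η hη =>
    (st_cont ν η hη).div continuousAt_id (hne η hη)
  have hsF : ∀ η : ℂ, 0 < η.im → FF ρ z (s η) = η ^ 2 := fun η hη => st_FF ρ z ν hsc η hη
  have hmul : ∀ η : ℂ, 0 < η.im → s η * η = stieltjes ν η := fun η hη =>
    div_mul_cancel₀ _ (hne η hη)
  have hpos : ∀ η : ℂ, 0 < η.im → (s η).im = 0 → 0 < (s η).re := by
    intro η hη h0
    have h1 := st_im_pos ν η hη
    rw [← hmul η hη, Complex.mul_im, h0, zero_mul, add_zero] at h1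
    exact pos_of_mul_pos_left h1 hη.le
  have hn : ∀ η : ℂ, 0 < η.im → ‖s η‖ ≤ 1 / η.im ^ 2 := by
    intro η hη
    have h1 := st_norm ν η hη
    have h2 : η.im ≤ ‖η‖ := (le_abs_self _).trans (Complex.abs_im_le_norm η)
    show ‖stieltjes ν η / η‖ ≤ _
    rw [norm_div]
    calc ‖stieltjes ν η‖ / ‖η‖ ≤ (1 / η.im) / η.im := by gcongr
      _ = 1 / η.im ^ 2 := by rw [div_div, sq]
  have hax := axis_real ρ hρ z r g S hr hg (hloc z) hup' s hsc' hsF hpos hn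
  have hstrip := strip_bound ρ z r g S c hr hr2 hg (by nlinarith) (hloc z) hup' s hsc' hsF hpos hax
  apply null_of_quad ν c (2 * (2 * S + 2 * c ^ 2 * S / g)) hc0
  intro e E he hec hE
  have h1 := st_interval ν E e he
  have h2 := hstrip e E he hec hE
  rw [hmul _ (by simpa using he)] at h2
  have h3 : 2 * e * (stieltjes ν (E + e * Complex.I)).im ≤
      2 * e * ((2 * S + 2 * c ^ 2 * S / g) * e) := by gcongr
  linarith

end
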